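/- Let (T, Σ_C) be a safe DL-Lite_R TBox with closed predicates. Then ABox consistency w.r.t. (T, Σ_C) is FO-rewritable: there is a first-order sentence s over concept and role names (with equality) such that for all ABoxes A, I_A ⊨ s iff A is consistent w.r.t. (T, Σ_C). -/

import Mathlib

namespace DL

/-- Roles: role names or inverse roles.  Role names are natural numbers. -/
inductive Role : Type
  | nm (r : ℕ) : Role
  | inv (r : ℕ) : Role
  deriving DecidableEq

/-- The inverse of a role. -/
def Role.flip : Role → Role
  | .nm r => .inv r
  | .inv r => .nm r

/-- The role name occurring in a role. -/
def Role.name : Role → ℕ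
  | .nm r => r
  | .inv r => r

/-- Interpretations.  Concept names, role names, and individual names are natural
numbers.  The standard name assumption is modelled by a partial, injective
interpretation `ind` of individual names: `ind a = some d` means that the individual
name `a` belongs to the domain and is (identified with) the element `d`. -/
structure Interp : Type 1 where
  Dom : Type
  dne : Nonempty Dom
  ind : ℕ → Option Dom
  ind_inj : ∀ a b d, ind a = some d → ind b = some d → a = b
  cInt : ℕ → Set Dom
  rInt : ℕ → Set (Dom × Dom)

/-- Extension of a (possibly inverse) role. -/
def Interp.rI (I : Interp) : Role → Set (I.Dom × I.Dom)
  | .nm r => I.rInt r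
  | .inv r => {p | (p.2, p.1) ∈ I.rInt r}

/-- ABoxes: sets of concept assertions `(A, a)` and role assertions `(r, a, b)`. -/
structure ABox : Type where
  ca : Set (ℕ × ℕ)
  ra : Set (ℕ × ℕ × ℕ)

/-- The individual names occurring in an ABox. -/
def ABox.ind (A : ABox) : Set ℕ :=
  {a | (∃ p ∈ A.ca, p.2 = a) ∨ (∃ t ∈ A.ra, t.2.1 = a ∨ t.2.2 = a)}

/-- The ABox is finite. -/
def ABox.Fin (A : ABox) : Prop := A.ca.Finite ∧ A.ra.Finite

/-- The ABox only uses concept names from `Sc` and role names from `Sr`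
(i.e. it is a `S`-ABox for the signature `S = Sc ∪ Sr`). -/
def ABox.usesOnly (A : ABox) (Sc Sr : Set ℕ) : Prop :=
  (∀ p ∈ A.ca, p.1 ∈ Sc) ∧ (∀ t ∈ A.ra, t.1 ∈ Sr)

/-- `I` is a model of the ABox `A` (under the standard name assumption). -/
def Interp.modelA (I : Interp) (A : ABox) : Prop :=
  (∀ p ∈ A.ca, ∃ d, I.ind p.2 = some d ∧ d ∈ I.cInt p.1) ∧
  (∀ t ∈ A.ra, ∃ d e, I.ind t.2.1 = some d ∧ I.ind t.2.2 = some e ∧ (d, e) ∈ I.rInt t.1)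

/-- `I` respects the closed predicates `Sc` (concept names) and `Sr` (role names)
with respect to the ABox `A`: the extension of each closed predicate is exactly
what is asserted in `A`. -/
def Interp.respects (I : Interp) (A : ABox) (Sc Sr : Set ℕ) : Prop :=
  (∀ B ∈ Sc, ∀ d, d ∈ I.cInt B ↔ ∃ a, I.ind a = some d ∧ (B, a) ∈ A.ca) ∧
  (∀ r ∈ Sr, ∀ d e, (d, e) ∈ I.rInt r ↔ ∃ a b, I.ind a = some d ∧ I.ind b = some e ∧ (r, a, b) ∈ A.ra)

/-- First-order queries built from concept atoms, role atoms and equality using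
negation, conjunction, disjunction and existential quantification.
Variables are natural numbers. -/
inductive FO : Type
  | eq (x y : ℕ)
  | capp (B x : ℕ)
  | rapp (r x y : ℕ)
  | neg (φ : FO)
  | conj (φ ψ : FO)
  | disj (φ ψ : FO)
  | ex (x : ℕ) (φ : FO)

/-- Standard first-order evaluation of a query in an interpretation under an
assignment. -/
def Interp.evalFO (I : Interp) : (ℕ → I.Dom) → FO → Prop
  | v, .eq x y => v x = v y
  | v, .capp B x => v x ∈ I.cInt B
  | v, .rapp r x y => (v x, v y) ∈ I.rInt r
  | v, .neg φ => ¬ I.evalFO v φ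
  | v, .conj φ ψ => I.evalFO v φ ∧ I.evalFO v ψ
  | v, .disj φ ψ => I.evalFO v φ ∨ I.evalFO v ψ
  | v, .ex x φ => ∃ d : I.Dom, I.evalFO (Function.update v x d) φ

/-- Free variables of a first-order query. -/
def FO.free : FO → Set ℕ
  | .eq x y => {x, y}
  | .capp _ x => {x}
  | .rapp _ x y => {x, y}
  | .neg φ => φ.free
  | .conj φ ψ => φ.free ∪ ψ.free
  | .disj φ ψ => φ.free ∪ ψ.free
  | .ex x φ => φ.free \ {x}

/-- Conjunctions of concept and role atoms. -/
inductive IsConjAtoms : FO → Prop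
  | capp (B x : ℕ) : IsConjAtoms (.capp B x)
  | rapp (r x y : ℕ) : IsConjAtoms (.rapp r x y)
  | conj {φ ψ : FO} : IsConjAtoms φ → IsConjAtoms ψ → IsConjAtoms (.conj φ ψ)

/-- Conjunctive queries: existentially quantified conjunctions of atoms. -/
inductive IsCQ : FO → Prop
  | base {φ : FO} : IsConjAtoms φ → IsCQ φ
  | ex {φ : FO} (x : ℕ) : IsCQ φ → IsCQ (.ex x φ)

/-- Unions of conjunctive queries: disjunctions of CQs. -/
inductive IsUCQ : FO → Prop
  | base {φ : FO} : IsCQ φ → IsUCQ φ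
  | disj {φ ψ : FO} : IsUCQ φ → IsUCQ ψ → IsUCQ (.disj φ ψ)

/-- `v` maps the answer variables `xs` to (the domain elements named by) the
individual names `as`. -/
def matches' (I : Interp) (xs as : List ℕ) (v : ℕ → I.Dom) : Prop :=
  ∀ p ∈ List.zip xs as, I.ind p.2 = some (v p.1)

/-- `I ⊨ q(as)`, where `xs` is the list of answer variables of `q`. -/
def Interp.sat (I : Interp) (q : FO) (xs as : List ℕ) : Prop :=
  ∃ v : ℕ → I.Dom, matches' I xs as v ∧ I.evalFO v q

/-- Certain answers of the ontology-mediated query with closed predicates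
`(T, Σ_C, q)` where the models of the TBox `T` are given by the predicate `mod`:
`as` is a certain answer to `q` (with answer variables `xs`) over `A` iff every
model of the TBox and `A` that respects the closed predicates satisfies `q(as)`. -/
def certAns (mod : Interp → Prop) (Sc Sr : Set ℕ) (A : ABox) (q : FO) (xs as : List ℕ) : Prop :=
  ∀ I : Interp, mod I → I.modelA A → I.respects A Sc Sr → I.sat q xs as

/-- `A` is consistent w.r.t. the TBox (given by `mod`) and the closed predicates. -/
def consistentW (mod : Interp → Prop) (Sc Sr : Set ℕ) (A : ABox) : Prop :=
  ∃ I : Interp, mod I ∧ I.modelA A ∧ I.respects A Sc Sr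

/-- DL-Lite basic concepts: concept names and unqualified existential
restrictions `∃ρ` over (possibly inverse) roles. -/
inductive Basic : Type
  | atom (B : ℕ)
  | ex (ρ : Role)
  deriving DecidableEq

/-- Semantics of basic concepts. -/
def Interp.semB (I : Interp) : Basic → Set I.Dom
  | .atom B => I.cInt B
  | .ex ρ => {d | ∃ e, (d, e) ∈ I.rI ρ}

/-- DL-Lite_R axioms: positive and negative concept inclusions between
basic concepts, and role inclusions. -/
inductive LiteAx : Type
  | pos (B₁ B₂ : Basic)
  | npos (B₁ B₂ : Basic)
  | ri (ρ σ : Role)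

/-- A DL-Lite_R TBox is a finite list of axioms. -/
abbrev LiteTBox := List LiteAx

/-- `I` is a model of the DL-Lite_R TBox `T`. -/
def Interp.modelLite (I : Interp) (T : LiteTBox) : Prop :=
  (∀ B₁ B₂ : Basic, LiteAx.pos B₁ B₂ ∈ T → I.semB B₁ ⊆ I.semB B₂) ∧
  (∀ B₁ B₂ : Basic, LiteAx.npos B₁ B₂ ∈ T → I.semB B₁ ∩ I.semB B₂ = ∅) ∧
  (∀ ρ σ : Role, LiteAx.ri ρ σ ∈ T → I.rI ρ ⊆ I.rI σ)

/-- `T ⊨ B₁ ⊑ B₂`. -/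
def liteEntPos (T : LiteTBox) (B₁ B₂ : Basic) : Prop :=
  ∀ I : Interp, I.modelLite T → I.semB B₁ ⊆ I.semB B₂

/-- `T ⊨ B₁ ⊑ ¬B₂`. -/
def liteEntNeg (T : LiteTBox) (B₁ B₂ : Basic) : Prop :=
  ∀ I : Interp, I.modelLite T → I.semB B₁ ∩ I.semB B₂ = ∅

/-- `T ⊨ ρ ⊑ σ`. -/
def liteEntRI (T : LiteTBox) (ρ σ : Role) : Prop :=
  ∀ I : Interp, I.modelLite T → I.rI ρ ⊆ I.rI σ

/-- `B` is satisfiable w.r.t. `T`. -/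
def liteSat (T : LiteTBox) (B : Basic) : Prop :=
  ∃ I : Interp, I.modelLite T ∧ (I.semB B).Nonempty

/-- Concept names occurring in a basic concept. -/
def Basic.sigC : Basic → Set ℕ
  | .atom B => {B}
  | .ex _ => ∅

/-- Role names occurring in a basic concept. -/
def Basic.sigR : Basic → Set ℕ
  | .atom _ => ∅
  | .ex ρ => {ρ.name}

/-- Safeness of a DL-Lite_R TBox with closed predicates `(T, S_C)` where
`S_C` consists of the concept names `Sc` and the role names `Sr`. -/
def LiteSafe (T : LiteTBox) (Sc Sr : Set ℕ) : Prop :=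
  ¬ ∃ (B₁ B₂ : Basic) (ρ : Role),
      liteSat T B₁ ∧
      liteEntPos T B₁ (.ex ρ) ∧ liteEntPos T (.ex ρ.flip) B₂ ∧
      (∀ ρ' : Role, liteEntRI T ρ' ρ → B₁ ≠ .ex ρ') ∧
      (B₂.sigC ⊆ Sc ∧ B₂.sigR ⊆ Sr) ∧
      (∀ ρ' : Role, liteEntPos T B₁ (.ex ρ') → liteEntRI T ρ' ρ → ρ'.name ∉ Sr)

/-- Active-domain evaluation of a first-order query over (the interpretation
`I_A` corresponding to) an ABox: quantifiers range over `Ind(A)`. -/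
def ABox.evalFO (A : ABox) : (ℕ → ℕ) → FO → Prop
  | v, .eq x y => v x = v y
  | v, .capp B x => (B, v x) ∈ A.ca
  | v, .rapp r x y => (r, v x, v y) ∈ A.ra
  | v, .neg φ => ¬ A.evalFO v φ
  | v, .conj φ ψ => A.evalFO v φ ∧ A.evalFO v ψ
  | v, .disj φ ψ => A.evalFO v φ ∨ A.evalFO v ψ
  | v, .ex x φ => ∃ a ∈ A.ind, A.evalFO (Function.update v x a) φ

/-- `I_A ⊨ p(as)` where `xs` are the answer variables of `p`. -/
def ABox.satFO (A : ABox) (p : FO) (xs as : List ℕ) : Prop :=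
  ∃ v : ℕ → ℕ, (∀ pr ∈ List.zip xs as, v pr.1 = pr.2) ∧ A.evalFO v p

/-- FO-rewritability of an ontology-mediated query whose certain answers are
given by `certain`, over the admissible ABoxes: there is a first-order formula
`p` with free variables among the answer variables `xs` such that for all
admissible ABoxes `A` and all tuples `as` from `Ind(A)`:
`I_A ⊨ p(as)` iff `as` is a certain answer. -/
def FORewritable (certain : ABox → List ℕ → Prop) (admissible : ABox → Prop)
    (xs : List ℕ) : Prop :=
  ∃ p : FO, p.free ⊆ {x | x ∈ xs} ∧
    ∀ A : ABox, admissible A →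
      ∀ as : List ℕ, as.length = xs.length → (∀ a ∈ as, a ∈ A.ind) →
        (A.satFO p xs as ↔ certain A as)

/-- Membership of an individual pair in a role over the ABox. -/
def ABox.memR (A : ABox) : Role → ℕ → ℕ → Prop
  | .nm r, a, b => (r, a, b) ∈ A.ra
  | .inv r, a, b => (r, b, a) ∈ A.ra

/-- Membership of an individual in a basic concept over the ABox. -/
def ABox.memB (A : ABox) : Basic → ℕ → Prop
  | .atom C, a => (C, a) ∈ A.ca
  | .ex ρ, a => ∃ b, A.memR ρ a b

/-- The predicate name occurring in a basic concept. -/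
def Basic.name : Basic → ℕ
  | .atom C => C
  | .ex ρ => ρ.name

/-- All predicates of a basic concept are closed. -/
def Basic.Closed (Sc Sr : Set ℕ) (B : Basic) : Prop := B.sigC ⊆ Sc ∧ B.sigR ⊆ Sr

@[simp] theorem Role.flip_flip (ρ : Role) : ρ.flip.flip = ρ := by cases ρ <;> rfl

@[simp] theorem Role.flip_name (ρ : Role) : ρ.flip.name = ρ.name := by cases ρ <;> rfl

theorem ABox.memR_flip (A : ABox) (ρ : Role) (a b : ℕ) :
    A.memR ρ.flip a b ↔ A.memR ρ b a := by cases ρ <;> rfl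

theorem Interp.rI_flip (I : Interp) (ρ : Role) (d e : I.Dom) :
    (d, e) ∈ I.rI ρ.flip ↔ (e, d) ∈ I.rI ρ := by cases ρ <;> rfl

theorem Basic.closed_ex {Sc Sr : Set ℕ} {ρ : Role} :
    (Basic.ex ρ).Closed Sc Sr ↔ ρ.name ∈ Sr := by
  simp [Basic.Closed, Basic.sigC, Basic.sigR]

theorem Basic.closed_atom {Sc Sr : Set ℕ} {C : ℕ} :
    (Basic.atom C).Closed Sc Sr ↔ C ∈ Sc := by
  simp [Basic.Closed, Basic.sigC, Basic.sigR]

theorem ABox.memR_ind {A : ABox} {ρ : Role} {a b : ℕ} (h : A.memR ρ a b) :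
    a ∈ A.ind ∧ b ∈ A.ind := by
  cases ρ with
  | nm r => exact ⟨Or.inr ⟨_, h, Or.inl rfl⟩, Or.inr ⟨_, h, Or.inr rfl⟩⟩
  | inv r => exact ⟨Or.inr ⟨_, h, Or.inr rfl⟩, Or.inr ⟨_, h, Or.inl rfl⟩⟩

theorem ABox.memB_ind {A : ABox} {B : Basic} {a : ℕ} (h : A.memB B a) : a ∈ A.ind := by
  cases B with
  | atom C => exact Or.inl ⟨_, h, rfl⟩
  | ex ρ => exact (ABox.memR_ind h.choose_spec).1

/-! ### First-order definability over ABoxes -/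

/-- A property of ABoxes and assignments defined by a formula with free variables in `X`. -/
def FODef (X : Set ℕ) (P : ABox → (ℕ → ℕ) → Prop) : Prop :=
  ∃ φ : FO, φ.free ⊆ X ∧ ∀ A v, A.evalFO v φ ↔ P A v

theorem FODef.mono {X Y : Set ℕ} {P} (h : FODef X P) (hXY : X ⊆ Y) : FODef Y P :=
  let ⟨φ, hf, he⟩ := h
  ⟨φ, hf.trans hXY, he⟩

theorem FODef.not {X P} (h : FODef X P) : FODef X (fun A v => ¬ P A v) :=
  let ⟨φ, hf, he⟩ := h
  ⟨.neg φ, hf, fun A v => not_congr (he A v)⟩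

theorem FODef.and {X P Q} (h : FODef X P) (h' : FODef X Q) :
    FODef X (fun A v => P A v ∧ Q A v) :=
  let ⟨φ, hf, he⟩ := h
  let ⟨ψ, hf', he'⟩ := h'
  ⟨.conj φ ψ, Set.union_subset hf hf', fun A v => and_congr (he A v) (he' A v)⟩

theorem FODef.imp {X P Q} (h : FODef X P) (h' : FODef X Q) :
    FODef X (fun A v => P A v → Q A v) := by
  have := (h.and h'.not).not
  simpa only [not_and, not_not] using this

theorem FODef.exists_ind {X P} (x : ℕ) (h : FODef (insert x X) P) :
    FODef X (fun A v => ∃ a ∈ A.ind, P A (Function.update v x a)) := by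
  obtain ⟨φ, hf, he⟩ := h
  refine ⟨.ex x φ, ?_, fun A v => ?_⟩
  · rintro y ⟨hy, hyx⟩
    exact (hf hy).resolve_left hyx
  · simp only [ABox.evalFO, he]

theorem FODef.forall_ind {X P} (x : ℕ) (h : FODef (insert x X) P) :
    FODef X (fun A v => ∀ a ∈ A.ind, P A (Function.update v x a)) := by
  have := (FODef.exists_ind x h.not).not
  simpa only [not_exists, not_and, not_not] using this

theorem FODef.true (X : Set ℕ) : FODef X (fun _ _ => True) :=
  ⟨.neg (.ex 0 (.neg (.eq 0 0))), by simp [FO.free], fun A v => by simp [ABox.evalFO]⟩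

theorem FODef.guard {X P} (p : Prop) (h : FODef X P) : FODef X (fun A v => p → P A v) := by
  by_cases hp : p
  · simpa [hp] using h
  · simpa [hp] using FODef.true X

theorem FODef.forall_finite {ι : Type} {X} {S : Set ι} (hS : S.Finite)
    {P : ι → ABox → (ℕ → ℕ) → Prop} (h : ∀ i, FODef X (P i)) :
    FODef X (fun A v => ∀ i ∈ S, P i A v) := by
  induction S, hS using Set.Finite.induction_on with
  | empty => simpa using FODef.true X
  | insert _ _ ih => simpa only [Set.forall_mem_insert] using (h _).and ih

theorem FODef.memR (ρ : Role) (x y : ℕ) : FODef {x, y} (fun A v => A.memR ρ (v x) (v y)) := by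
  cases ρ with
  | nm r => exact ⟨.rapp r x y, subset_rfl, fun _ _ => Iff.rfl⟩
  | inv r => exact ⟨.rapp r y x, (Set.pair_comm y x).subset, fun _ _ => Iff.rfl⟩

theorem FODef.memB (B : Basic) : FODef {0} (fun A v => A.memB B (v 0)) := by
  cases B with
  | atom C => exact ⟨.capp C 0, subset_rfl, fun _ _ => Iff.rfl⟩
  | ex ρ =>
    obtain ⟨φ, hf, he⟩ := FODef.exists_ind 1 ((FODef.memR ρ 0 1).mono (Set.pair_comm 0 1).subset)
    refine ⟨φ, hf, fun A v => (he A v).trans ?_⟩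
    simp only [Function.update_self, ne_eq, zero_ne_one, not_false_eq_true,
      Function.update_of_ne]
    exact ⟨fun ⟨b, _, h⟩ => ⟨b, h⟩, fun ⟨b, h⟩ => ⟨b, (ABox.memR_ind h).2, h⟩⟩

theorem finite_setOf_roleName_lt (n : ℕ) : {ρ : Role | ρ.name < n}.Finite := by
  refine (((Set.finite_Iio n).image Role.nm).union ((Set.finite_Iio n).image Role.inv)).subset ?_
  rintro (r | r) h
  · exact Or.inl ⟨r, h, rfl⟩
  · exact Or.inr ⟨r, h, rfl⟩

theorem finite_setOf_basicName_lt (n : ℕ) : {B : Basic | B.name < n}.Finite := by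
  refine (((Set.finite_Iio n).image Basic.atom).union
    ((finite_setOf_roleName_lt n).image Basic.ex)).subset ?_
  rintro (C | ρ) h
  · exact Or.inl ⟨C, h, rfl⟩
  · exact Or.inr ⟨ρ, h, rfl⟩

/-! ### The consistency criterion -/

/-- The conditions on an ABox, over predicate names below `n`, which characterise
consistency with respect to a safe TBox with closed predicates. -/
structure Criterion (T : LiteTBox) (Sc Sr : Set ℕ) (n : ℕ) (A : ABox) : Prop where
  disjoint : ∀ B₁ ∈ {B : Basic | B.name < n}, ∀ B₂ ∈ {B : Basic | B.name < n},
    liteEntNeg T B₁ B₂ → ∀ a ∈ A.ind, ¬ (A.memB B₁ a ∧ A.memB B₂ a)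
  concept : ∀ B₁ ∈ {B : Basic | B.name < n}, ∀ B₂ ∈ {B : Basic | B.name < n},
    (B₂.Closed Sc Sr ∧ liteEntPos T B₁ B₂) → ∀ a ∈ A.ind, A.memB B₁ a → A.memB B₂ a
  role : ∀ ρ ∈ {ρ : Role | ρ.name < n}, ∀ σ ∈ {ρ : Role | ρ.name < n},
    (σ.name ∈ Sr ∧ liteEntRI T ρ σ) → ∀ a ∈ A.ind, ∀ b ∈ A.ind, A.memR ρ a b → A.memR σ a b

theorem criterion_definable (T : LiteTBox) (Sc Sr : Set ℕ) (n : ℕ) :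
    FODef ∅ (fun A _ => Criterion T Sc Sr n A) := by
  have hB := finite_setOf_basicName_lt n
  have hR := finite_setOf_roleName_lt n
  have h1 := FODef.forall_finite hB fun B₁ => FODef.forall_finite hB fun B₂ =>
    FODef.guard (liteEntNeg T B₁ B₂) <| FODef.forall_ind (X := ∅) 0 <|
      FODef.mono ((FODef.memB B₁).and (FODef.memB B₂)).not (by simp)
  have h2 := FODef.forall_finite hB fun B₁ => FODef.forall_finite hB fun B₂ =>
    FODef.guard (B₂.Closed Sc Sr ∧ liteEntPos T B₁ B₂) <| FODef.forall_ind (X := ∅) 0 <|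
      FODef.mono ((FODef.memB B₁).imp (FODef.memB B₂)) (by simp)
  have h3 := FODef.forall_finite hR fun ρ => FODef.forall_finite hR fun σ =>
    FODef.guard (σ.name ∈ Sr ∧ liteEntRI T ρ σ) <| FODef.forall_ind (X := ∅) 0 <|
      FODef.forall_ind 1 <|
        FODef.mono ((FODef.memR ρ 0 1).imp (FODef.memR σ 0 1)) (by simp [Set.pair_comm])
  obtain ⟨φ, hf, he⟩ := h1.and (h2.and h3)
  refine ⟨φ, hf, fun A v => (he A v).trans ?_⟩
  simp only [Function.update_self, ne_eq, zero_ne_one, not_false_eq_true, Function.update_of_ne]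
  exact ⟨fun h => ⟨h.1, h.2.1, h.2.2⟩, fun h => ⟨h.disjoint, h.concept, h.role⟩⟩

/-! ### Necessity -/

theorem Interp.modelA.memR {I : Interp} {A : ABox} (h : I.modelA A) {ρ : Role} {a b : ℕ}
    (hm : A.memR ρ a b) : ∃ d e, I.ind a = some d ∧ I.ind b = some e ∧ (d, e) ∈ I.rI ρ := by
  cases ρ with
  | nm r => exact h.2 _ hm
  | inv r =>
    obtain ⟨d, e, hd, he, hr⟩ := h.2 _ hm
    exact ⟨e, d, he, hd, hr⟩

theorem Interp.modelA.memB {I : Interp} {A : ABox} (h : I.modelA A) {B : Basic} {a : ℕ}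
    (hm : A.memB B a) : ∃ d, I.ind a = some d ∧ d ∈ I.semB B := by
  cases B with
  | atom C => exact h.1 _ hm
  | ex ρ =>
    obtain ⟨b, hb⟩ := hm
    obtain ⟨d, e, hd, -, hr⟩ := h.memR hb
    exact ⟨d, hd, e, hr⟩

theorem Interp.respects.memR {I : Interp} {A : ABox} {Sc Sr : Set ℕ} (h : I.respects A Sc Sr)
    {ρ : Role} (hρ : ρ.name ∈ Sr) {d e : I.Dom} (hm : (d, e) ∈ I.rI ρ) :
    ∃ a b, I.ind a = some d ∧ I.ind b = some e ∧ A.memR ρ a b := by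
  cases ρ with
  | nm r => exact (h.2 r hρ d e).1 hm
  | inv r =>
    obtain ⟨a, b, ha, hb, hr⟩ := (h.2 r hρ e d).1 hm
    exact ⟨b, a, hb, ha, hr⟩

theorem Interp.respects.memB {I : Interp} {A : ABox} {Sc Sr : Set ℕ} (h : I.respects A Sc Sr)
    {B : Basic} (hB : B.Closed Sc Sr) {d : I.Dom} (hm : d ∈ I.semB B) :
    ∃ a, I.ind a = some d ∧ A.memB B a := by
  cases B with
  | atom C => exact (h.1 C (Basic.closed_atom.1 hB) d).1 hm
  | ex ρ =>
    obtain ⟨e, he⟩ := hm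
    obtain ⟨a, b, ha, -, hr⟩ := h.memR (Basic.closed_ex.1 hB) he
    exact ⟨a, ha, b, hr⟩

theorem criterion_of_consistent {T : LiteTBox} {Sc Sr : Set ℕ} {A : ABox} (n : ℕ)
    (h : consistentW (fun I => I.modelLite T) Sc Sr A) : Criterion T Sc Sr n A := by
  obtain ⟨I, hT, hA, hC⟩ := h
  refine ⟨?_, ?_, ?_⟩
  · rintro B₁ - B₂ - hneg a - ⟨h₁, h₂⟩
    obtain ⟨d, hd, hd₁⟩ := hA.memB h₁
    obtain ⟨d', hd', hd₂⟩ := hA.memB h₂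
    obtain rfl : d = d' := Option.some.inj (hd.symm.trans hd')
    exact (Set.eq_empty_iff_forall_notMem.1 (hneg I hT) d) ⟨hd₁, hd₂⟩
  · rintro B₁ - B₂ - ⟨hcl, hpos⟩ a - h₁
    obtain ⟨d, hd, hd₁⟩ := hA.memB h₁
    obtain ⟨a', ha', hm⟩ := hC.memB hcl (hpos I hT hd₁)
    rwa [I.ind_inj a a' d hd ha']
  · rintro ρ - σ - ⟨hcl, hri⟩ a - b - h₁
    obtain ⟨d, e, hd, he, hr⟩ := hA.memR h₁
    obtain ⟨a', b', ha', hb', hm⟩ := hC.memR hcl (hri I hT hr)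
    rwa [I.ind_inj a a' d hd ha', I.ind_inj b b' e he hb']

/-! ### Entailment -/

theorem liteEntRI.flip {T : LiteTBox} {ρ σ : Role} (h : liteEntRI T ρ σ) :
    liteEntRI T ρ.flip σ.flip := by
  rintro I hI ⟨d, e⟩ hde
  rw [Interp.rI_flip] at hde ⊢
  exact h I hI hde

theorem liteEntRI.trans {T : LiteTBox} {ρ σ τ : Role} (h : liteEntRI T ρ σ)
    (h' : liteEntRI T σ τ) : liteEntRI T ρ τ := fun I hI => (h I hI).trans (h' I hI)

theorem liteEntRI.pos {T : LiteTBox} {ρ σ : Role} (h : liteEntRI T ρ σ) :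
    liteEntPos T (.ex ρ) (.ex σ) := fun I hI _ ⟨e, he⟩ => ⟨e, h I hI he⟩

theorem liteEntPos.trans {T : LiteTBox} {B C D : Basic} (h : liteEntPos T B C)
    (h' : liteEntPos T C D) : liteEntPos T B D := fun I hI => (h I hI).trans (h' I hI)

theorem liteSat.mono {T : LiteTBox} {B C : Basic} (h : liteSat T B) (h' : liteEntPos T B C) :
    liteSat T C :=
  let ⟨I, hI, hne⟩ := h
  ⟨I, hI, hne.mono (h' I hI)⟩

theorem liteSat.flip {T : LiteTBox} {ρ : Role} (h : liteSat T (.ex ρ)) :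
    liteSat T (.ex ρ.flip) :=
  let ⟨I, hI, d, e, he⟩ := h
  ⟨I, hI, e, d, (I.rI_flip ρ e d).2 he⟩

theorem liteEntNeg.of_pos {T : LiteTBox} {B₁ B₂ C₁ C₂ : Basic} (h₁ : liteEntPos T B₁ C₁)
    (h₂ : liteEntPos T B₂ C₂) (h : liteEntNeg T C₁ C₂) : liteEntNeg T B₁ B₂ := fun I hI =>
  Set.subset_empty_iff.1 ((Set.inter_subset_inter (h₁ I hI) (h₂ I hI)).trans (h I hI).subset)

theorem liteSat_of_not_entNeg {T : LiteTBox} {B : Basic} (h : ¬ liteEntNeg T B B) :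
    liteSat T B := by
  simp only [liteEntNeg, not_forall, Set.inter_self] at h
  obtain ⟨I, hI, hne⟩ := h
  exact ⟨I, hI, Set.nonempty_iff_ne_empty.2 hne⟩

theorem liteSat.not_entNeg {T : LiteTBox} {B : Basic} (h : liteSat T B) :
    ¬ liteEntNeg T B B := by
  obtain ⟨I, hI, hne⟩ := h
  intro hn
  have := hn I hI
  rw [Set.inter_self] at this
  exact hne.ne_empty this

/-! ### Names not occurring in the TBox -/

/-- All predicate names of an axiom lie below `n`. -/
def LiteAx.Below (n : ℕ) : LiteAx → Prop
  | .pos B C => B.name < n ∧ C.name < n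
  | .npos B C => B.name < n ∧ C.name < n
  | .ri ρ σ => ρ.name < n ∧ σ.name < n

theorem LiteAx.Below.mono {m n : ℕ} (hmn : m ≤ n) {α : LiteAx} (h : α.Below m) :
    α.Below n := by
  cases α <;> exact ⟨h.1.trans_le hmn, h.2.trans_le hmn⟩

theorem LiteAx.exists_below (α : LiteAx) : ∃ n, α.Below n := by
  cases α with
  | pos B C => exact ⟨max B.name C.name + 1, by simp [Below]⟩
  | npos B C => exact ⟨max B.name C.name + 1, by simp [Below]⟩
  | ri B C => exact ⟨max B.name C.name + 1, by simp [Below]⟩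

theorem LiteTBox.exists_below (T : LiteTBox) : ∃ n, ∀ α ∈ T, α.Below n := by
  induction T with
  | nil => exact ⟨0, by simp⟩
  | cons α T ih =>
    obtain ⟨n, hn⟩ := ih
    obtain ⟨m, hm⟩ := α.exists_below
    refine ⟨max m n, ?_⟩
    rintro β (_ | ⟨_, hβ⟩)
    · exact hm.mono (le_max_left _ _)
    · exact (hn β hβ).mono (le_max_right _ _)

/-- The one-point interpretation in which exactly the predicates with names at least `n`
are nonempty. -/
def freshInterp (n : ℕ) : Interp where
  Dom := Unit
  dne := ⟨()⟩
  ind := fun _ => none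
  ind_inj := by simp
  cInt := fun C => {_d | n ≤ C}
  rInt := fun r => {_p | n ≤ r}

theorem mem_freshInterp_rI {n : ℕ} {ρ : Role} {p : Unit × Unit} :
    p ∈ (freshInterp n).rI ρ ↔ n ≤ ρ.name := by cases ρ <;> rfl

theorem mem_freshInterp_semB {n : ℕ} {B : Basic} {d : Unit} :
    d ∈ (freshInterp n).semB B ↔ n ≤ B.name := by
  cases B with
  | atom C => rfl
  | ex ρ =>
    exact ⟨fun ⟨_, h⟩ => mem_freshInterp_rI.1 h, fun h => ⟨(), mem_freshInterp_rI.2 h⟩⟩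

theorem freshInterp_modelLite {T : LiteTBox} {n : ℕ} (hn : ∀ α ∈ T, α.Below n) :
    (freshInterp n).modelLite T := by
  refine ⟨fun B C h d hd => ?_, fun B C h => ?_, fun ρ σ h p hp => ?_⟩
  · exact absurd (hn _ h).1 (not_lt.2 (mem_freshInterp_semB.1 hd))
  · refine Set.eq_empty_iff_forall_notMem.2 fun d hd => ?_
    exact absurd (hn _ h).1 (not_lt.2 (mem_freshInterp_semB.1 hd.1))
  · exact absurd (hn _ h).1 (not_lt.2 (mem_freshInterp_rI.1 hp))

theorem liteEntPos.name_lt {T : LiteTBox} {n : ℕ} (hn : ∀ α ∈ T, α.Below n) {B C : Basic}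
    (h : liteEntPos T B C) (hC : C.name < n) : B.name < n := by
  by_contra! hB
  have := h _ (freshInterp_modelLite hn) (mem_freshInterp_semB (d := ()).2 hB)
  exact absurd hC (not_lt.2 (mem_freshInterp_semB.1 this))

theorem liteEntRI.name_lt {T : LiteTBox} {n : ℕ} (hn : ∀ α ∈ T, α.Below n) {ρ σ : Role}
    (h : liteEntRI T ρ σ) (hσ : σ.name < n) : ρ.name < n := by
  by_contra! hρ
  have := h _ (freshInterp_modelLite hn) (mem_freshInterp_rI (p := ((), ())).2 hρ)
  exact absurd hσ (not_lt.2 (mem_freshInterp_rI.1 this))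

theorem liteSat_of_le_name {T : LiteTBox} {n : ℕ} (hn : ∀ α ∈ T, α.Below n) {B : Basic}
    (h : n ≤ B.name) : liteSat T B :=
  ⟨_, freshInterp_modelLite hn, (), mem_freshInterp_semB.2 h⟩

/-! ### The canonical model -/

/-- A satisfiable role whose anonymous successors need no closed predicate. -/
def OpenRole (T : LiteTBox) (Sc Sr : Set ℕ) (ρ : Role) : Prop :=
  liteSat T (.ex ρ) ∧ ∀ B : Basic, liteEntPos T (.ex ρ.flip) B → ¬ B.Closed Sc Sr

/-- The basic concepts holding at the elements of the canonical model, which are the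
individuals together with one anonymous witness per role. -/
inductive CanonType (T : LiteTBox) (Sc Sr : Set ℕ) (A : ABox) : ℕ ⊕ Role → Basic → Prop
  | named {a : ℕ} {B C : Basic} (hm : A.memB B a) (h : liteEntPos T B C) :
      CanonType T Sc Sr A (.inl a) C
  | witness {d : ℕ ⊕ Role} {ρ : Role} {C : Basic} (hd : CanonType T Sc Sr A d (.ex ρ))
      (hρ : OpenRole T Sc Sr ρ) (h : liteEntPos T (.ex ρ.flip) C) :
      CanonType T Sc Sr A (.inr ρ) C

/-- The role extensions of the canonical model. -/
inductive CanonRel (T : LiteTBox) (Sc Sr : Set ℕ) (A : ABox) (σ : Role) :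
    ℕ ⊕ Role → ℕ ⊕ Role → Prop
  | named {a b : ℕ} {ρ : Role} (hm : A.memR ρ a b) (h : liteEntRI T ρ σ) :
      CanonRel T Sc Sr A σ (.inl a) (.inl b)
  | succ {d : ℕ ⊕ Role} {ρ : Role} (hd : CanonType T Sc Sr A d (.ex ρ))
      (hρ : OpenRole T Sc Sr ρ) (h : liteEntRI T ρ σ) : CanonRel T Sc Sr A σ d (.inr ρ)
  | pred {d : ℕ ⊕ Role} {ρ : Role} (hd : CanonType T Sc Sr A d (.ex ρ))
      (hρ : OpenRole T Sc Sr ρ) (h : liteEntRI T ρ σ.flip) : CanonRel T Sc Sr A σ (.inr ρ) d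

/-- The canonical model. -/
def canonInterp (T : LiteTBox) (Sc Sr : Set ℕ) (A : ABox) : Interp where
  Dom := ℕ ⊕ Role
  dne := ⟨.inl 0⟩
  ind := fun a => some (.inl a)
  ind_inj := fun _ _ _ ha hb => Sum.inl_injective (Option.some.inj (ha.trans hb.symm))
  cInt := fun C => {d | CanonType T Sc Sr A d (.atom C)}
  rInt := fun r => {p | CanonRel T Sc Sr A (.nm r) p.1 p.2}

section Canonical

variable {T : LiteTBox} {Sc Sr : Set ℕ} {A : ABox}

theorem CanonType.mono {d : ℕ ⊕ Role} {B C : Basic} (h : CanonType T Sc Sr A d B)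
    (hBC : liteEntPos T B C) : CanonType T Sc Sr A d C := by
  cases h with
  | named hm h => exact .named hm (h.trans hBC)
  | witness hd hρ h => exact .witness hd hρ (h.trans hBC)

theorem CanonRel.flip {d e : ℕ ⊕ Role} {σ : Role} (h : CanonRel T Sc Sr A σ d e) :
    CanonRel T Sc Sr A σ.flip e d := by
  cases h with
  | named hm h => exact .named ((A.memR_flip _ _ _).2 hm) h.flip
  | succ hd hρ h => exact .pred hd hρ (by rwa [Role.flip_flip])
  | pred hd hρ h => exact .succ hd hρ h

theorem CanonRel.mono {d e : ℕ ⊕ Role} {σ τ : Role} (h : CanonRel T Sc Sr A σ d e)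
    (hστ : liteEntRI T σ τ) : CanonRel T Sc Sr A τ d e := by
  cases h with
  | named hm h => exact .named hm (h.trans hστ)
  | succ hd hρ h => exact .succ hd hρ (h.trans hστ)
  | pred hd hρ h => exact .pred hd hρ (h.trans hστ.flip)

theorem mem_canonInterp_rI {σ : Role} {d e : ℕ ⊕ Role} :
    (d, e) ∈ (canonInterp T Sc Sr A).rI σ ↔ CanonRel T Sc Sr A σ d e := by
  cases σ with
  | nm r => rfl
  | inv r => exact ⟨fun h => CanonRel.flip (σ := .nm r) h, fun h => h.flip⟩

theorem CanonRel.canonType {d e : ℕ ⊕ Role} {σ : Role} (h : CanonRel T Sc Sr A σ d e) :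
    CanonType T Sc Sr A d (.ex σ) := by
  cases h with
  | named hm h => exact .named (B := .ex _) ⟨_, hm⟩ h.pos
  | succ hd hρ h => exact hd.mono h.pos
  | pred hd hρ h =>
    refine .witness hd hρ ?_
    have := h.flip.pos
    rwa [Role.flip_flip] at this

theorem Criterion.liteSat_of_memB {n : ℕ} (hn : ∀ α ∈ T, α.Below n)
    (hA : Criterion T Sc Sr n A) {B : Basic} {a : ℕ} (hm : A.memB B a) : liteSat T B := by
  by_cases hB : B.name < n
  · exact liteSat_of_not_entNeg fun h => hA.disjoint B hB B hB h a (ABox.memB_ind hm) ⟨hm, hm⟩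
  · exact liteSat_of_le_name hn (not_lt.1 hB)

theorem Criterion.memB_of_closed {n : ℕ} (hn : ∀ α ∈ T, α.Below n)
    (hcl : ∀ B : Basic, B.Closed Sc Sr → B.name < n) (hA : Criterion T Sc Sr n A)
    {B C : Basic} {a : ℕ} (hm : A.memB B a) (h : liteEntPos T B C) (hC : C.Closed Sc Sr) :
    A.memB C a :=
  hA.concept B (h.name_lt hn (hcl C hC)) C (hcl C hC) ⟨hC, h⟩ a (ABox.memB_ind hm) hm

/-- For a safe TBox, a required successor that cannot be anonymous either already exists
or is required along a closed subrole. -/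
theorem LiteSafe.exists_closed_of_not_open (hsafe : LiteSafe T Sc Sr) {B : Basic} {σ : Role}
    (hB : liteSat T B) (h : liteEntPos T B (.ex σ)) (hσ : ¬ OpenRole T Sc Sr σ) :
    (∃ ρ, liteEntRI T ρ σ ∧ B = .ex ρ) ∨
      ∃ ρ, liteEntPos T B (.ex ρ) ∧ liteEntRI T ρ σ ∧ ρ.name ∈ Sr := by
  by_contra! hcon
  refine hσ ⟨hB.mono h, fun C hC hcl => hsafe ⟨B, C, σ, hB, h, hC, hcon.1, hcl, hcon.2⟩⟩

theorem CanonType.exists_rel {n : ℕ} (hn : ∀ α ∈ T, α.Below n)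
    (hcl : ∀ B : Basic, B.Closed Sc Sr → B.name < n) (hsafe : LiteSafe T Sc Sr)
    (hA : Criterion T Sc Sr n A) {d : ℕ ⊕ Role} {σ : Role}
    (h : CanonType T Sc Sr A d (.ex σ)) : ∃ e, CanonRel T Sc Sr A σ d e := by
  by_cases hσ : OpenRole T Sc Sr σ
  · exact ⟨.inr σ, .succ h hσ fun _ _ => subset_rfl⟩
  cases h with
  | named hm h =>
    rcases hsafe.exists_closed_of_not_open (hA.liteSat_of_memB hn hm) h hσ with
      ⟨ρ, hρ, rfl⟩ | ⟨ρ, hB, hρ, hρcl⟩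
    · obtain ⟨b, hb⟩ := hm
      exact ⟨_, .named hb hρ⟩
    · obtain ⟨b, hb⟩ := hA.memB_of_closed hn hcl hm hB (Basic.closed_ex.2 hρcl)
      exact ⟨_, .named hb hρ⟩
  | witness hd hρ h =>
    rcases hsafe.exists_closed_of_not_open hρ.1.flip h hσ with
      ⟨τ, hτ, hB⟩ | ⟨τ, hB, -, hτcl⟩
    · obtain rfl := Basic.ex.inj hB
      refine ⟨_, .pred hd hρ ?_⟩
      have := hτ.flip
      rwa [Role.flip_flip] at this
    · exact absurd (Basic.closed_ex.2 hτcl) (hρ.2 _ hB)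

theorem consistent_of_criterion {n : ℕ} (hn : ∀ α ∈ T, α.Below n)
    (hcl : ∀ B : Basic, B.Closed Sc Sr → B.name < n) (hsafe : LiteSafe T Sc Sr)
    (hA : Criterion T Sc Sr n A) : consistentW (fun I => I.modelLite T) Sc Sr A := by
  have hsem : ∀ {B : Basic} {d : ℕ ⊕ Role},
      d ∈ (canonInterp T Sc Sr A).semB B ↔ CanonType T Sc Sr A d B := by
    intro B d
    cases B with
    | atom C => rfl
    | ex σ =>
      refine ⟨fun ⟨e, he⟩ => (mem_canonInterp_rI.1 he).canonType, fun h => ?_⟩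
      obtain ⟨e, he⟩ := h.exists_rel hn hcl hsafe hA
      exact ⟨e, mem_canonInterp_rI.2 he⟩
  refine ⟨canonInterp T Sc Sr A, ⟨?_, ?_, ?_⟩, ⟨?_, ?_⟩, ?_, ?_⟩
  · intro B C h d hd
    exact hsem.2 ((hsem.1 hd).mono fun I hI => hI.1 B C h)
  · intro C₁ C₂ h
    refine Set.eq_empty_iff_forall_notMem.2 fun d hd => ?_
    have hneg : liteEntNeg T C₁ C₂ := fun I hI => hI.2.1 C₁ C₂ h
    have h₁ := hsem.1 hd.1
    have h₂ := hsem.1 hd.2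
    cases h₁ with
    | named hm₁ hp₁ =>
      cases h₂ with
      | named hm₂ hp₂ =>
        exact hA.disjoint _ (hp₁.name_lt hn (hn _ h).1) _ (hp₂.name_lt hn (hn _ h).2)
          (hneg.of_pos hp₁ hp₂) _ (ABox.memB_ind hm₁) ⟨hm₁, hm₂⟩
    | witness _ hρ hp₁ =>
      cases h₂ with
      | witness _ _ hp₂ => exact hρ.1.flip.not_entNeg (hneg.of_pos hp₁ hp₂)
  · rintro ρ σ h ⟨d, e⟩ hde
    exact mem_canonInterp_rI.2 ((mem_canonInterp_rI.1 hde).mono fun I hI => hI.2.2 ρ σ h)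
  · rintro ⟨C, a⟩ h
    exact ⟨.inl a, rfl, .named (B := .atom C) h fun _ _ => subset_rfl⟩
  · rintro ⟨r, a, b⟩ h
    exact ⟨.inl a, .inl b, rfl, rfl, .named (ρ := .nm r) h fun _ _ => subset_rfl⟩
  · intro C hC d
    have hC' : (Basic.atom C).Closed Sc Sr := Basic.closed_atom.2 hC
    constructor
    · intro h
      cases (show CanonType T Sc Sr A d (.atom C) from h) with
      | named hm hp => exact ⟨_, rfl, hA.memB_of_closed hn hcl hm hp hC'⟩
      | witness _ hρ hp => exact absurd hC' (hρ.2 _ hp)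
    · rintro ⟨a, ha, h⟩
      obtain rfl := Option.some.inj ha
      exact .named (B := .atom C) h fun _ _ => subset_rfl
  · intro r hr d e
    have hnm : (Role.nm r).name < n := hcl (.ex (.nm r)) (Basic.closed_ex.2 hr)
    constructor
    · intro h
      cases (show CanonRel T Sc Sr A (.nm r) d e from h) with
      | named hm hp =>
        exact ⟨_, _, rfl, rfl, hA.role _ (hp.name_lt hn hnm) (.nm r) hnm ⟨hr, hp⟩ _
          (ABox.memR_ind hm).1 _ (ABox.memR_ind hm).2 hm⟩
      | succ _ hρ hp => exact absurd (Basic.closed_ex.2 hr) (hρ.2 (.ex (.inv r)) hp.flip.pos)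
      | pred _ hρ hp => exact absurd (Basic.closed_ex.2 hr) (hρ.2 (.ex (.nm r)) hp.flip.pos)
    · rintro ⟨a, b, ha, hb, h⟩
      obtain rfl := Option.some.inj ha
      obtain rfl := Option.some.inj hb
      exact .named (ρ := .nm r) h fun _ _ => subset_rfl

end Canonical

/-- Let `(T, S_C)` be a safe DL-Lite_R TBox with closed
predicates.  Then ABox consistency w.r.t. `(T, S_C)` is FO-rewritable: there is a
first-order sentence `s` such that for all (finite) ABoxes `A`:
`I_A ⊨ s` iff `A` is consistent w.r.t. `(T, S_C)`. -/
theorem statement_8 (T : LiteTBox) (Sc Sr : Set ℕ)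
    (hfin : Sc.Finite ∧ Sr.Finite) (hsafe : LiteSafe T Sc Sr) :
    ∃ s : FO, s.free = ∅ ∧
      ∀ A : ABox, A.Fin →
        ((∀ v : ℕ → ℕ, A.evalFO v s) ↔ consistentW (fun I => I.modelLite T) Sc Sr A) := by
  obtain ⟨k, hk⟩ := LiteTBox.exists_below T
  obtain ⟨c, hc⟩ := hfin.1.bddAbove
  obtain ⟨r, hr⟩ := hfin.2.bddAbove
  set n := max k (max (c + 1) (r + 1))
  have hn : ∀ α ∈ T, α.Below n := fun α h => (hk α h).mono (le_max_left _ _)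
  have hcl : ∀ B : Basic, B.Closed Sc Sr → B.name < n := by
    rintro (C | ρ) h
    · have : C ≤ c := hc (Basic.closed_atom.1 h)
      simp only [Basic.name]
      omega
    · have : ρ.name ≤ r := hr (Basic.closed_ex.1 h)
      simp only [Basic.name]
      omega
  obtain ⟨φ, hf, he⟩ := criterion_definable T Sc Sr n
  refine ⟨φ, Set.subset_empty_iff.1 hf, fun A _ => ⟨fun h => ?_, fun h v => ?_⟩⟩
  · exact consistent_of_criterion hn hcl hsafe ((he A fun _ => 0).1 (h _))
  · exact (he A v).2 (criterion_of_consistent n h)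

end DL
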